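/- Let α > 0, Γ > 0, and let Λ be a real number with Λ ≥ 1/3. Then there is no x > 0 such that l(x) = Λ, where l(x) = α p(x)/(α + √Γ g(x)); hence the delay equation ω'(t) = a[l(ω(t-τ₁)^{1/3}) ω(t-τ₁) - Λ ω(t-τ₂)] has no positive stationary solution. -/

import Mathlib

lemma aux_pos (f f' : ℝ → ℝ) (hf : ∀ x, HasDerivAt f (f' x) x) (h0 : f 0 = 0)
    (h : ∀ x, 0 < x → 0 < f' x) (x : ℝ) (hx : 0 < x) : 0 < f x := by
  have hm : StrictMonoOn f (Set.Ici 0) := by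
    apply strictMonoOn_of_deriv_pos (convex_Ici 0)
    · exact fun y _ => (hf y).continuousAt.continuousWithinAt
    · intro y hy
      rw [interior_Ici] at hy
      rw [(hf y).deriv]
      exact h y hy
  have := hm (Set.mem_Ici.2 le_rfl) (Set.mem_Ici.2 hx.le) hx
  rwa [h0] at this

lemma aux_one (x : ℝ) (hx : 0 < x) : 0 < x * Real.cosh x - Real.sinh x := by
  refine aux_pos (fun x => x * Real.cosh x - Real.sinh x) (fun x => x * Real.sinh x)
    ?_ (by simp) ?_ x hx
  · intro y
    have h := ((hasDerivAt_id y).mul (Real.hasDerivAt_cosh y)).sub (Real.hasDerivAt_sinh y)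
    refine h.congr_deriv ?_
    simp
  · intro y hy
    exact mul_pos hy (Real.sinh_pos_iff.2 hy)

lemma aux_two (x : ℝ) (hx : 0 < x) :
    0 < x ^ 2 * Real.sinh x - 3 * (x * Real.cosh x - Real.sinh x) := by
  refine aux_pos (fun x => x ^ 2 * Real.sinh x - 3 * (x * Real.cosh x - Real.sinh x))
    (fun x => x * (x * Real.cosh x - Real.sinh x)) ?_ (by simp) ?_ x hx
  · intro y
    have h := ((hasDerivAt_pow 2 y).mul (Real.hasDerivAt_sinh y)).sub
      ((((hasDerivAt_id y).mul (Real.hasDerivAt_cosh y)).sub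
        (Real.hasDerivAt_sinh y)).const_mul 3)
    refine h.congr_deriv ?_
    simp
    ring
  · intro y hy
    exact mul_pos hy (aux_one y hy)

/-- Let `α > 0`, `Γ > 0`, and `Λ ≥ 1/3`. Then there is no `x > 0` with `l(x) = Λ`;
hence the delay equation `ω'(t) = a[l(ω(t-τ₁)^{1/3}) ω(t-τ₁) - Λ ω(t-τ₂)]` has no
positive stationary solution. -/
theorem no_positive_stationary (α Γ Λ a : ℝ) (hα : 0 < α) (hΓ : 0 < Γ)
    (hΛ : 1 / 3 ≤ Λ) (ha : 0 < a)
    (g p l : ℝ → ℝ)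
    (hg : ∀ x, g x = Real.cosh x / Real.sinh x - 1 / x)
    (hp : ∀ x, p x = (x * (Real.cosh x / Real.sinh x) - 1) / x ^ 2)
    (hl : ∀ x, l x = α * p x / (α + Real.sqrt Γ * g x)) :
    (¬∃ x : ℝ, 0 < x ∧ l x = Λ) ∧
    (¬∃ ω : ℝ, 0 < ω ∧ a * (l (ω ^ ((1 : ℝ) / 3)) * ω - Λ * ω) = 0) := by
  have key : ∀ x : ℝ, 0 < x → l x < Λ := by
    intro x hx
    have hs : 0 < Real.sinh x := Real.sinh_pos_iff.2 hx
    have hgx : 0 < g x := by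
      rw [hg, show Real.cosh x / Real.sinh x - 1 / x
        = (x * Real.cosh x - Real.sinh x) / (x * Real.sinh x) by field_simp]
      exact div_pos (aux_one x hx) (mul_pos hx hs)
    have hpx : p x < 1 / 3 := by
      rw [hp, show (x * (Real.cosh x / Real.sinh x) - 1) / x ^ 2
        = (x * Real.cosh x - Real.sinh x) / (x ^ 2 * Real.sinh x) by field_simp,
        div_lt_iff₀ (by positivity)]
      linarith [aux_two x hx]
    have hG : 0 < Real.sqrt Γ * g x := mul_pos (Real.sqrt_pos.2 hΓ) hgx
    refine lt_of_lt_of_le ?_ hΛ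
    rw [hl, div_lt_iff₀ (by linarith)]
    nlinarith [mul_lt_mul_of_pos_left hpx hα]
  constructor
  · rintro ⟨x, hx, h⟩
    exact (key x hx).ne h
  · rintro ⟨ω, hω, h⟩
    have h1 := key (ω ^ ((1 : ℝ) / 3)) (Real.rpow_pos_of_pos hω _)
    have h2 := (mul_eq_zero.1 h).resolve_left ha.ne'
    nlinarith [mul_lt_mul_of_pos_right h1 hω]
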